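/- polcCTL is strictly less expressive than polcCTL(p): there exists a polcCTL(p) formula that is equivalent over Σ-trees (Σ = 2^AP with p, q, r, s ∈ AP) to the CTL* formula E((p ∨ q U r) U s), whereas no polcCTL formula is equivalent to E((p ∨ q U r) U s). -/

import Mathlib

set_option maxHeartbeats 1000000

namespace FOTrees

/-- An unranked, unordered, finitely-branching infinite tree:
a connected acyclic graph with a total (every node has a successor),
finitely-branching transition relation, rooted at `root`. -/
structure Tree (V : Type) where
  root : V
  edge : V → V → Prop
  total : ∀ v, ∃ w, edge v w
  finBranch : ∀ v, {w | edge v w}.Finite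
  rootNoParent : ∀ v, ¬ edge v root
  parentUnique : ∀ ⦃u v w : V⦄, edge u w → edge v w → u = v
  reach : ∀ v, Relation.ReflTransGen edge root v
  acyclic : ∀ v, ¬ Relation.TransGen edge v v

/-- A finite (non-empty) path of a tree: it starts at the root and each
element after the first is a child of its predecessor. -/
def IsFinPath {V : Type} (t : Tree V) (π : List V) : Prop :=
  π ≠ [] ∧ π.head? = some t.root ∧
    ∀ (i : ℕ) (h : i + 1 < π.length),
      t.edge (π[i]'(Nat.lt_of_succ_lt h)) (π[i + 1]'h)

/-- An infinite path of a tree. -/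
def IsInfPath {V : Type} (t : Tree V) (π : ℕ → V) : Prop :=
  π 0 = t.root ∧ ∀ i, t.edge (π i) (π (i + 1))

/-- A Σ-labelled tree (Σ = 2^AP), bundled together with its type of vertices. -/
structure STree (AP : Type) where
  V : Type
  t : Tree V
  τ : V → Set AP

end FOTrees
namespace FOTrees

/-- Formulas of polarized counting CTL with past, polcCTL(p):
`φ ::= D^n φ | p | ¬φ | φ ∨ φ | EXφ | E(φ U φ) | Yφ | φ S φ`. -/
inductive PCTLp (AP : Type) : Type where
  | atom : AP → PCTLp AP
  | neg  : PCTLp AP → PCTLp AP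
  | or   : PCTLp AP → PCTLp AP → PCTLp AP
  | D    : ℕ → PCTLp AP → PCTLp AP
  | EX   : PCTLp AP → PCTLp AP
  | EU   : PCTLp AP → PCTLp AP → PCTLp AP
  | Y    : PCTLp AP → PCTLp AP
  | S    : PCTLp AP → PCTLp AP → PCTLp AP

/-- Two infinite paths coincide up to position `i`. -/
def InfCoincide {V : Type} (π π' : ℕ → V) (i : ℕ) : Prop := ∀ k ≤ i, π k = π' k

/-- Satisfaction of a polcCTL(p) formula at a Σ-tree, an infinite path and a
position on the path. -/
def PCTLp.Sat {V AP : Type} (t : Tree V) (τ : V → Set AP) :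
    PCTLp AP → (ℕ → V) → ℕ → Prop
  | .atom p, π, i => p ∈ τ (π i)
  | .neg φ, π, i => ¬ PCTLp.Sat t τ φ π i
  | .or φ ψ, π, i => PCTLp.Sat t τ φ π i ∨ PCTLp.Sat t τ ψ π i
  | .D n φ, π, i =>
      ∃ f : Fin n → (ℕ → V),
        (∀ j, IsInfPath t (f j)) ∧
        (∀ j, InfCoincide (f j) π i) ∧
        (∀ j k, j ≠ k → f j (i + 1) ≠ f k (i + 1)) ∧
        (∀ j, PCTLp.Sat t τ φ (f j) (i + 1))
  | .EX φ, π, i =>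
      ∃ π', IsInfPath t π' ∧ InfCoincide π' π i ∧ PCTLp.Sat t τ φ π' (i + 1)
  | .EU φ ψ, π, i =>
      ∃ π', IsInfPath t π' ∧ InfCoincide π' π i ∧
        ∃ j, i ≤ j ∧ PCTLp.Sat t τ ψ π' j ∧
          ∀ k, i ≤ k → k < j → PCTLp.Sat t τ φ π' k
  | .Y φ, π, i => 0 < i ∧ PCTLp.Sat t τ φ π (i - 1)
  | .S φ ψ, π, i =>
      ∃ j, j ≤ i ∧ PCTLp.Sat t τ ψ π j ∧ ∀ k, j < k → k ≤ i → PCTLp.Sat t τ φ π k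

/-- A Σ-tree is a model of a polcCTL(p) formula iff the formula is satisfied
at position 0 of every infinite path. -/
def PCTLp.ModelsT {AP : Type} (T : STree AP) (φ : PCTLp AP) : Prop :=
  ∀ π, IsInfPath T.t π → PCTLp.Sat T.t T.τ φ π 0

/-- Equivalence of polcCTL(p) formulas: they agree at position 0 of every
infinite path of every Σ-tree. -/
def PCTLp.Equiv {AP : Type} (φ ψ : PCTLp AP) : Prop :=
  ∀ (V : Type) (t : Tree V) (τ : V → Set AP) (π : ℕ → V),
    IsInfPath t π → (PCTLp.Sat t τ φ π 0 ↔ PCTLp.Sat t τ ψ π 0)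

/-- The fragment polcCTL of polcCTL(p): no past operators `Y` and `S`. -/
def PCTLp.NoPast {AP : Type} : PCTLp AP → Prop
  | .atom _ => True
  | .neg φ => φ.NoPast
  | .or φ ψ => φ.NoPast ∧ ψ.NoPast
  | .D _ φ => φ.NoPast
  | .EX φ => φ.NoPast
  | .EU φ ψ => φ.NoPast ∧ ψ.NoPast
  | .Y _ => False
  | .S _ _ => False

/-- Conjunction (abbreviation). -/
def PCTLp.pand {AP : Type} (φ ψ : PCTLp AP) : PCTLp AP := .neg (.or (.neg φ) (.neg ψ))

end FOTrees
namespace FOTrees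

/-- Satisfaction of the CTL* formula `E((p ∨ q U r) U s)` at a Σ-tree, an
infinite path `π` and a position `i` (with the usual LTL semantics of `U`
on infinite paths). -/
def EStarSat {V AP : Type} (t : Tree V) (τ : V → Set AP) (p q r s : AP)
    (π : ℕ → V) (i : ℕ) : Prop :=
  ∃ π', IsInfPath t π' ∧ InfCoincide π' π i ∧
    ∃ j, i ≤ j ∧ s ∈ τ (π' j) ∧
      ∀ k, i ≤ k → k < j →
        (p ∈ τ (π' k) ∨
          ∃ m, k ≤ m ∧ r ∈ τ (π' m) ∧ ∀ l, k ≤ l → l < m → q ∈ τ (π' l))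

end FOTrees
namespace FOTrees

section PastFormula

variable {AP : Type} (p q r s : AP)

/-- Along the path read so far there is an obligation `q U r`, incurred at a position where only
`q` holds, that has not been discharged yet. -/
def pendingFormula : PCTLp AP :=
  .S (.neg (.atom r)) (.pand (.neg (.atom p)) (.pand (.atom q) (.neg (.atom r))))

/-- The current position does not violate `p ∨ q U r`, nor an obligation incurred before. -/
def safeFormula : PCTLp AP :=
  .or (.atom q) (.or (.atom r) (.pand (.atom p) (.neg (.Y (pendingFormula p q r)))))

/-- The position carries `s`, and obligations still pending can be met from here on. -/
def goalFormula : PCTLp AP :=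
  .pand (.atom s) (.or (.neg (.Y (pendingFormula p q r))) (.EU (.atom q) (.atom r)))

variable {V : Type} (t : Tree V) (τ : V → Set AP)

lemma sat_pand (φ ψ : PCTLp AP) (π : ℕ → V) (i : ℕ) :
    PCTLp.Sat t τ (.pand φ ψ) π i ↔ PCTLp.Sat t τ φ π i ∧ PCTLp.Sat t τ ψ π i := by
  simp [PCTLp.pand, PCTLp.Sat]

/-- Semantics of `Y (pendingFormula p q r)`, shifted to strict past positions. -/
lemma sat_Y_pendingFormula (π : ℕ → V) (i : ℕ) :
    PCTLp.Sat t τ (.Y (pendingFormula p q r)) π i ↔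
      ∃ a < i, p ∉ τ (π a) ∧ q ∈ τ (π a) ∧ ∀ b, a ≤ b → b < i → r ∉ τ (π b) := by
  simp only [pendingFormula, PCTLp.Sat, sat_pand]
  constructor
  · rintro ⟨hi, a, ha, ⟨hp, hq, hr⟩, hb⟩
    refine ⟨a, by omega, hp, hq, fun b hab hbi => ?_⟩
    rcases hab.eq_or_lt with rfl | hab
    · exact hr
    · exact hb b hab (by omega)
  · rintro ⟨a, ha, hp, hq, hb⟩
    exact ⟨by omega, a, by omega, ⟨hp, hq, hb a le_rfl ha⟩,
      fun b hab hbi => hb b hab.le (by omega)⟩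

lemma sat_safeFormula (π : ℕ → V) (i : ℕ) :
    PCTLp.Sat t τ (safeFormula p q r) π i ↔
      q ∈ τ (π i) ∨ r ∈ τ (π i) ∨ (p ∈ τ (π i) ∧
        ¬ ∃ a < i, p ∉ τ (π a) ∧ q ∈ τ (π a) ∧ ∀ b, a ≤ b → b < i → r ∉ τ (π b)) := by
  rw [← sat_Y_pendingFormula p q r t τ]
  simp only [safeFormula, sat_pand, PCTLp.Sat]

lemma sat_goalFormula (π : ℕ → V) (i : ℕ) :
    PCTLp.Sat t τ (goalFormula p q r s) π i ↔
      s ∈ τ (π i) ∧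
        ((¬ ∃ a < i, p ∉ τ (π a) ∧ q ∈ τ (π a) ∧ ∀ b, a ≤ b → b < i → r ∉ τ (π b)) ∨
          ∃ π', IsInfPath t π' ∧ InfCoincide π' π i ∧
            ∃ m, i ≤ m ∧ r ∈ τ (π' m) ∧ ∀ l, i ≤ l → l < m → q ∈ τ (π' l)) := by
  rw [← sat_Y_pendingFormula p q r t τ]
  simp only [goalFormula, sat_pand, PCTLp.Sat]

/-- The word-level content of the translation, from the past-time conditions to `p ∨ q U r`. -/
lemma until_of_safe {P Q R : ℕ → Prop} {j : ℕ}
    (safe : ∀ k < j, Q k ∨ R k ∨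
      (P k ∧ ¬ ∃ a < k, ¬ P a ∧ Q a ∧ ∀ b, a ≤ b → b < k → ¬ R b))
    (goal : (¬ ∃ a < j, ¬ P a ∧ Q a ∧ ∀ b, a ≤ b → b < j → ¬ R b) ∨
      ∃ m, j ≤ m ∧ R m ∧ ∀ l, j ≤ l → l < m → Q l) {k : ℕ} (hk : k < j) :
    P k ∨ ∃ m, k ≤ m ∧ R m ∧ ∀ l, k ≤ l → l < m → Q l := by
  classical
  by_cases hP : P k
  · exact .inl hP
  refine .inr ?_
  by_cases hR : R k
  · exact ⟨k, le_rfl, hR, fun l h₁ h₂ => by omega⟩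
  have hQ : Q k := by
    have := safe k hk
    tauto
  have stay : ∀ l, k ≤ l → l < j → (∀ b, k ≤ b → b ≤ l → ¬ R b) → Q l := by
    intro l hkl hlj hb
    rcases hkl.eq_or_lt with rfl | hkl
    · exact hQ
    rcases safe l hlj with h | h | h
    · exact h
    · exact absurd h (hb l hkl.le le_rfl)
    · exact absurd ⟨k, hkl, hP, hQ, fun b h₁ h₂ => hb b h₁ h₂.le⟩ h.2
  by_cases hex : ∃ m, k ≤ m ∧ m < j ∧ R m
  · refine ⟨Nat.find hex, (Nat.find_spec hex).1, (Nat.find_spec hex).2.2, fun l hkl hl => ?_⟩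
    have hj := (Nat.find_spec hex).2.1
    exact stay l hkl (by omega) fun b h₁ h₂ hRb =>
      Nat.find_min hex (show b < _ by omega) ⟨h₁, by omega, hRb⟩
  · push Not at hex
    rcases goal with h | ⟨m, hjm, hRm, hm⟩
    · exact absurd ⟨k, hk, hP, hQ, hex⟩ h
    · refine ⟨m, by omega, hRm, fun l hkl hlm => ?_⟩
      rcases lt_or_ge l j with hlj | hlj
      · exact stay l hkl hlj fun b h₁ h₂ => hex b h₁ (by omega)
      · exact hm l hlj hlm

/-- An obligation still pending at position `j` is met at some position from `j` on. -/
lemma until_of_pending {P Q R : ℕ → Prop} {j : ℕ}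
    (h : ∀ k < j, P k ∨ ∃ m, k ≤ m ∧ R m ∧ ∀ l, k ≤ l → l < m → Q l)
    (hpend : ∃ a < j, ¬ P a ∧ Q a ∧ ∀ b, a ≤ b → b < j → ¬ R b) :
    ∃ m, j ≤ m ∧ R m ∧ ∀ l, j ≤ l → l < m → Q l := by
  obtain ⟨a, haj, hP, -, hb⟩ := hpend
  obtain ⟨m, ham, hRm, hm⟩ := (h a haj).resolve_left hP
  refine ⟨m, ?_, hRm, fun l h₁ h₂ => hm l (by omega) h₂⟩
  by_contra! hlt
  exact hb m ham hlt hRm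

/-- The word-level content of the translation, from `p ∨ q U r` to the past-time conditions. -/
lemma safe_of_until {P Q R : ℕ → Prop} {j : ℕ}
    (h : ∀ k < j, P k ∨ ∃ m, k ≤ m ∧ R m ∧ ∀ l, k ≤ l → l < m → Q l) {k : ℕ} (hk : k < j) :
    Q k ∨ R k ∨ (P k ∧ ¬ ∃ a < k, ¬ P a ∧ Q a ∧ ∀ b, a ≤ b → b < k → ¬ R b) := by
  have split : (∃ m, k ≤ m ∧ R m ∧ ∀ l, k ≤ l → l < m → Q l) → Q k ∨ R k := by
    rintro ⟨m, hkm, hRm, hm⟩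
    rcases hkm.eq_or_lt with rfl | hkm
    · exact .inr hRm
    · exact .inl (hm k le_rfl hkm)
  have hpend := until_of_pending (j := k) fun l hl => h l (hl.trans hk)
  rcases h k hk with hP | hex
  · by_contra! hcon
    exact (split (hpend (hcon.2.2 hP))).elim hcon.1 hcon.2.1
  · exact (split hex).imp_right .inl

lemma sat_past_iff_eStarSat (π : ℕ → V) :
    PCTLp.Sat t τ (.EU (safeFormula p q r) (goalFormula p q r s)) π 0 ↔
      EStarSat t τ p q r s π 0 := by
  simp only [PCTLp.Sat, EStarSat, sat_safeFormula, sat_goalFormula]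
  constructor
  · rintro ⟨π', hπ', hco, j, -, ⟨hs, goal⟩, safe⟩
    obtain ⟨π'', hπ'', hco', goal'⟩ : ∃ π'', IsInfPath t π'' ∧ InfCoincide π'' π' j ∧
        ((¬ ∃ a < j, p ∉ τ (π' a) ∧ q ∈ τ (π' a) ∧ ∀ b, a ≤ b → b < j → r ∉ τ (π' b)) ∨
          ∃ m, j ≤ m ∧ r ∈ τ (π'' m) ∧ ∀ l, j ≤ l → l < m → q ∈ τ (π'' l)) := by
      rcases goal with h | ⟨π'', h₁, h₂, h₃⟩
      · exact ⟨π', hπ', fun _ _ => rfl, .inl h⟩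
      · exact ⟨π'', h₁, h₂, .inr h₃⟩
    refine ⟨π'', hπ'', fun k hk => (hco' k (by omega)).trans (hco k hk), j, Nat.zero_le _,
      by rwa [hco' j le_rfl], fun k _ hk => ?_⟩
    refine until_of_safe (P := fun k => p ∈ τ (π'' k)) (Q := fun k => q ∈ τ (π'' k))
      (R := fun k => r ∈ τ (π'' k)) (j := j) (fun k hk => ?_) ?_ hk
    · rcases safe k (Nat.zero_le _) hk with h | h | ⟨h, h'⟩
      · exact .inl (by rwa [hco' k hk.le])
      · exact .inr (.inl (by rwa [hco' k hk.le]))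
      · refine .inr (.inr ⟨by rwa [hco' k hk.le], fun ⟨a, hak, h₁, h₂, h₃⟩ => h' ?_⟩)
        rw [hco' a (by omega)] at h₁ h₂
        exact ⟨a, hak, h₁, h₂, fun b hb hb' => by
          rw [← hco' b (by omega)]; exact h₃ b hb hb'⟩
    · refine goal'.imp_left fun h' ⟨a, hak, h₁, h₂, h₃⟩ => h' ?_
      rw [hco' a (by omega)] at h₁ h₂
      exact ⟨a, hak, h₁, h₂, fun b hb hb' => by
        rw [← hco' b (by omega)]; exact h₃ b hb hb'⟩
  · rintro ⟨π', hπ', hco, j, -, hs, h⟩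
    have h' := fun k hk => h k (Nat.zero_le _) hk
    refine ⟨π', hπ', hco, j, Nat.zero_le _, ⟨hs, ?_⟩, fun k _ hk => safe_of_until h' hk⟩
    by_cases hpend : ∃ a < j, p ∉ τ (π' a) ∧ q ∈ τ (π' a) ∧
        ∀ b, a ≤ b → b < j → r ∉ τ (π' b)
    · exact .inr ⟨π', hπ', fun _ _ => rfl, until_of_pending h' hpend⟩
    · exact .inl hpend

end PastFormula

section Models

/-- States of the finite-state systems whose unravellings separate the two logics: a letter
together with a flag and a level. -/
inductive St : Type where
  | p : Bool → ℕ → St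
  | q : Bool → ℕ → St
  | r : Bool → ℕ → St

/-- The transition function. At a `q`-state of positive level one moves to a `p`-state with an
arbitrary flag or to an `r`-state; the latter can have the flag `true` only if the `q`-state does.
From `r` one moves to `p` and from `p` to `q`, keeping the flag. -/
def St.next : St → Bool × Bool → St
  | .p x m, _ => .q x m
  | .q x 0, _ => .q x 0
  | .q x (m + 1), c => if c.1 then .p c.2 m else .r (x && c.2) m
  | .r x m, _ => .p x m

/-- States are labelled by their letter, except at level `0`, where `q true 0` carries `s` and
`q false 0` carries nothing. -/
def St.label {AP : Type} (p q r s : AP) : St → Set AP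
  | .p _ _ => {p}
  | .q true 0 => {s}
  | .q false 0 => ∅
  | .q _ (_ + 1) => {q}
  | .r _ _ => {r}

/-- The infinite 4-ary tree; a node is the list of directions leading to it, last one first. -/
def fullTree : Tree (List (Bool × Bool)) where
  root := []
  edge v w := ∃ c, w = c :: v
  total v := ⟨(false, false) :: v, _, rfl⟩
  finBranch v := (Set.finite_range fun c : Bool × Bool => c :: v).subset <| by
    rintro _ ⟨c, rfl⟩
    exact ⟨c, rfl⟩
  rootNoParent := by simp
  parentUnique := by
    rintro u v w ⟨c, rfl⟩ ⟨d, h⟩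
    exact (List.cons.inj h).2
  reach v := by
    induction v with
    | nil => exact .refl
    | cons c v ih => exact ih.tail ⟨c, rfl⟩
  acyclic v h := by
    have key : ∀ u w : List (Bool × Bool),
        Relation.TransGen (fun v w => ∃ c, w = c :: v) u w → u.length < w.length := by
      intro u w h
      induction h with
      | single h => obtain ⟨c, rfl⟩ := h; simp
      | tail _ h ih => obtain ⟨c, rfl⟩ := h; simp; omega
    exact lt_irrefl _ (key v v h)

/-- The state reached from `x₀` at a node of the full tree. -/
def stateAt (x₀ : St) : List (Bool × Bool) → St
  | [] => x₀
  | c :: v => (stateAt x₀ v).next c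

/-- The path that follows `π` up to position `i` and then always takes direction `c`. -/
def extend (π : ℕ → List (Bool × Bool)) (i : ℕ) (c : Bool × Bool) : ℕ → List (Bool × Bool) :=
  fun n => List.replicate (n - i) c ++ π (min n i)

lemma isInfPath_extend {π : ℕ → List (Bool × Bool)} (hπ : IsInfPath fullTree π) (i : ℕ)
    (c : Bool × Bool) : IsInfPath fullTree (extend π i c) := by
  refine ⟨by simpa [extend] using hπ.1, fun n => ?_⟩
  rcases lt_or_ge n i with h | h
  · simpa [extend, Nat.sub_eq_zero_of_le h.le, Nat.sub_eq_zero_of_le (Nat.succ_le_of_lt h),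
      min_eq_left h.le, min_eq_left (Nat.succ_le_of_lt h)] using hπ.2 n
  · refine ⟨c, ?_⟩
    simp [extend, min_eq_right h, min_eq_right (h.trans n.le_succ), Nat.succ_sub h,
      List.replicate_succ]

lemma infCoincide_extend (π : ℕ → List (Bool × Bool)) (i : ℕ) (c : Bool × Bool) :
    InfCoincide (extend π i c) π i := fun k hk => by
  simp [extend, Nat.sub_eq_zero_of_le hk, min_eq_left hk]

lemma extend_succ (π : ℕ → List (Bool × Bool)) (i : ℕ) (c : Bool × Bool) :
    extend π i c (i + 1) = c :: π i := by
  simp [extend]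

/-- `E(A U B)` for state predicates `A` and `B`. -/
inductive St.Until (A B : St → Prop) : St → Prop where
  | base {x} : B x → St.Until A B x
  | step {x} (c) : A x → St.Until A B (x.next c) → St.Until A B x

variable {AP : Type}

/-- State-based semantics of formulas without past operators. -/
def PCTLp.StSat (lab : St → Set AP) : PCTLp AP → St → Prop
  | .atom a, x => a ∈ lab x
  | .neg φ, x => ¬ φ.StSat lab x
  | .or φ ψ, x => φ.StSat lab x ∨ ψ.StSat lab x
  | .D n φ, x => ∃ f : Fin n → Bool × Bool, Function.Injective f ∧ ∀ j, φ.StSat lab (x.next (f j))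
  | .EX φ, x => ∃ c, φ.StSat lab (x.next c)
  | .EU φ ψ, x => St.Until (φ.StSat lab) (ψ.StSat lab) x
  | .Y _, _ => False
  | .S _ _, _ => False

lemma until_of_path (x₀ : St) {A B : St → Prop} {π : ℕ → List (Bool × Bool)}
    (hπ : IsInfPath fullTree π) {i j : ℕ} (hij : i ≤ j) (hB : B (stateAt x₀ (π j)))
    (hA : ∀ k, i ≤ k → k < j → A (stateAt x₀ (π k))) : St.Until A B (stateAt x₀ (π i)) := by
  induction hij using Nat.decreasingInduction with
  | self => exact .base hB
  | of_succ i hi ih =>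
    obtain ⟨c, hc⟩ := hπ.2 i
    refine .step c (hA i le_rfl hi) ?_
    have := ih fun k h₁ h₂ => hA k (by omega) h₂
    rwa [hc] at this

lemma exists_path_of_until (x₀ : St) {A B : St → Prop} {x : St} (h : St.Until A B x)
    {π : ℕ → List (Bool × Bool)} (hπ : IsInfPath fullTree π) {i : ℕ}
    (hx : stateAt x₀ (π i) = x) :
    ∃ π', IsInfPath fullTree π' ∧ InfCoincide π' π i ∧
      ∃ j, i ≤ j ∧ B (stateAt x₀ (π' j)) ∧ ∀ k, i ≤ k → k < j → A (stateAt x₀ (π' k)) := by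
  induction h generalizing π i with
  | base hB => exact ⟨π, hπ, fun _ _ => rfl, i, le_rfl, by rwa [hx], fun k _ _ => by omega⟩
  | step c hA _ ih =>
    obtain ⟨π', hπ', hco, j, hij, hB, hk⟩ := ih (isInfPath_extend hπ i c) (i := i + 1)
      (by rw [extend_succ, stateAt, hx])
    have hco' : InfCoincide π' π i := fun k hk =>
      (hco k (by omega)).trans (infCoincide_extend π i c k hk)
    refine ⟨π', hπ', hco', j, by omega, hB, fun k h₁ h₂ => ?_⟩
    rcases h₁.eq_or_lt with rfl | h₁
    · rwa [hco' i le_rfl, hx]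
    · exact hk k h₁ h₂

lemma sat_iff_stSat (x₀ : St) (lab : St → Set AP) {φ : PCTLp AP} (hφ : φ.NoPast)
    {π : ℕ → List (Bool × Bool)} (hπ : IsInfPath fullTree π) (i : ℕ) :
    PCTLp.Sat fullTree (fun v => lab (stateAt x₀ v)) φ π i ↔
      φ.StSat lab (stateAt x₀ (π i)) := by
  induction φ generalizing π i with
  | atom a => rfl
  | neg φ ih => exact not_congr (ih hφ hπ i)
  | or φ ψ ihφ ihψ => exact or_congr (ihφ hφ.1 hπ i) (ihψ hφ.2 hπ i)
  | D n φ ih =>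
    constructor
    · rintro ⟨f, hf, hco, hne, hsat⟩
      have hc : ∀ j, ∃ c, f j (i + 1) = c :: π i := fun j => by
        rw [← hco j i le_rfl]; exact (hf j).2 i
      choose g hg using hc
      refine ⟨g, fun j k hjk => ?_, fun j => ?_⟩
      · by_contra h
        exact hne j k h (by rw [hg, hg, hjk])
      · have := (ih hφ (hf j) (i + 1)).1 (hsat j)
        rwa [hg] at this
    · rintro ⟨g, hg, hsat⟩
      refine ⟨fun j => extend π i (g j), fun j => isInfPath_extend hπ i _,
        fun j => infCoincide_extend π i _, fun j k hjk h => hjk (hg ?_), fun j => ?_⟩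
      · simpa [extend_succ] using h
      · rw [ih hφ (isInfPath_extend hπ i _), extend_succ]
        exact hsat j
  | EX φ ih =>
    constructor
    · rintro ⟨π', hπ', hco, hsat⟩
      obtain ⟨c, hc⟩ := hπ'.2 i
      rw [ih hφ hπ', hc, hco i le_rfl] at hsat
      exact ⟨c, hsat⟩
    · rintro ⟨c, hc⟩
      refine ⟨extend π i c, isInfPath_extend hπ i c, infCoincide_extend π i c, ?_⟩
      rwa [ih hφ (isInfPath_extend hπ i c), extend_succ]
  | EU φ ψ ihφ ihψ =>
    constructor
    · rintro ⟨π', hπ', hco, j, hij, hψ, hk⟩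
      have := until_of_path x₀ hπ' hij ((ihψ hφ.2 hπ' j).1 hψ)
        fun k h₁ h₂ => (ihφ hφ.1 hπ' k).1 (hk k h₁ h₂)
      rwa [hco i le_rfl] at this
    · intro h
      obtain ⟨π', hπ', hco, j, hij, hψ, hk⟩ := exists_path_of_until x₀ h hπ rfl
      exact ⟨π', hπ', hco, j, hij, (ihψ hφ.2 hπ' j).2 hψ,
        fun k h₁ h₂ => (ihφ hφ.1 hπ' k).2 (hk k h₁ h₂)⟩
  | Y φ => exact hφ.elim
  | S φ ψ => exact hφ.elim

/-- From level `k` on, `A` depends only on the letter of a state. -/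
structure St.Stable (k : ℕ) (A : St → Prop) : Prop where
  p : ∀ {x m}, k ≤ m → (A (.p x m) ↔ A (.p true k))
  q : ∀ {x m}, k ≤ m → (A (.q x m) ↔ A (.q true k))
  r : ∀ {x m}, k ≤ m → (A (.r x m) ↔ A (.r true k))

namespace St

variable {k : ℕ} {A B : St → Prop}

lemma Stable.mono (h : Stable k A) {k' : ℕ} (hk : k ≤ k') : Stable k' A where
  p hm := (h.p (hk.trans hm)).trans (h.p hk).symm
  q hm := (h.q (hk.trans hm)).trans (h.q hk).symm
  r hm := (h.r (hk.trans hm)).trans (h.r hk).symm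

lemma Stable.not (h : Stable k A) : Stable k fun x => ¬ A x where
  p hm := not_congr (h.p hm)
  q hm := not_congr (h.q hm)
  r hm := not_congr (h.r hm)

lemma Stable.or (hA : Stable k A) (hB : Stable k B) : Stable k fun x => A x ∨ B x where
  p hm := or_congr (hA.p hm) (hB.p hm)
  q hm := or_congr (hA.q hm) (hB.q hm)
  r hm := or_congr (hA.r hm) (hB.r hm)

lemma Stable.next (h : Stable k A) (c : Bool × Bool) : Stable (k + 1) fun x => A (x.next c) where
  p hm := (h.q (by omega)).trans (h.q (by omega)).symm
  q {x m} hm := by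
    obtain ⟨m, rfl⟩ : ∃ n, m = n + 1 := ⟨m - 1, by omega⟩
    rcases c with ⟨_ | _, c⟩
    · exact (h.r (by omega)).trans (h.r (by omega)).symm
    · exact (h.p (by omega)).trans (h.p (by omega)).symm
  r hm := (h.p (by omega)).trans (h.p (by omega)).symm

lemma Stable.exists {ι : Sort*} {F : ι → St → Prop} (h : ∀ i, Stable k (F i)) :
    Stable k fun x => ∃ i, F i x where
  p hm := exists_congr fun i => (h i).p hm
  q hm := exists_congr fun i => (h i).q hm
  r hm := exists_congr fun i => (h i).r hm

lemma Stable.forall {ι : Sort*} {F : ι → St → Prop} (h : ∀ i, Stable k (F i)) :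
    Stable k fun x => ∀ i, F i x where
  p hm := forall_congr' fun i => (h i).p hm
  q hm := forall_congr' fun i => (h i).q hm
  r hm := forall_congr' fun i => (h i).r hm

lemma Stable.const_and (P : Prop) (h : Stable k A) : Stable k fun x => P ∧ A x where
  p hm := and_congr_right fun _ => h.p hm
  q hm := and_congr_right fun _ => h.q hm
  r hm := and_congr_right fun _ => h.r hm

/-- Some `q`-state of level `k` satisfies `A` and the until. -/
def Entry (k : ℕ) (A B : St → Prop) : Prop :=
  A (.q true k) ∧ ∃ x, Until A B (.q x k)

/-- What an until starting at a `p`-state of high level amounts to. -/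
def UntilP (k : ℕ) (A B : St → Prop) : Prop :=
  B (.p true k) ∨
    A (.p true k) ∧ (B (.q true k) ∨ A (.q true k) ∧ B (.r true k) ∨ Entry k A B)

/-- What an until starting at a `q`-state of high level amounts to. -/
def UntilQ (k : ℕ) (A B : St → Prop) : Prop :=
  B (.q true k) ∨
    A (.q true k) ∧ (B (.p true k) ∨ B (.r true k) ∨ A (.p true k) ∧ Entry k A B)

/-- What an until starting at an `r`-state of high level amounts to. -/
def UntilR (k : ℕ) (A B : St → Prop) : Prop :=
  B (.r true k) ∨ A (.r true k) ∧ UntilP k A B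

lemma Until.high (hA : Stable k A) (hB : Stable k B) {y : St} (h : Until A B y) :
    (∀ x m, y = .p x m → k ≤ m → UntilP k A B) ∧
    (∀ x m, y = .q x m → k < m → UntilQ k A B) ∧
    (∀ x m, y = .r x m → k ≤ m → UntilR k A B) := by
  induction h with
  | base h =>
    refine ⟨?_, ?_, ?_⟩ <;> rintro x m rfl hm
    · exact .inl ((hB.p hm).1 h)
    · exact .inl ((hB.q hm.le).1 h)
    · exact .inl ((hB.r hm).1 h)
  | step c ha hu ih =>
    obtain ⟨ihp, ihq, ihr⟩ := ih
    refine ⟨?_, ?_, ?_⟩ <;> rintro x m rfl hm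
    · rw [hA.p hm] at ha
      rcases hm.eq_or_lt with rfl | hm
      · cases hu with
        | base h => exact .inr ⟨ha, .inl ((hB.q le_rfl).1 h)⟩
        | step d h h' =>
          exact .inr ⟨ha, .inr (.inr ⟨(hA.q le_rfl).1 h, x, .step d h h'⟩)⟩
      · have := ihq x m rfl hm
        simp only [UntilP, UntilQ] at this ⊢
        tauto
    · rw [hA.q hm.le] at ha
      obtain ⟨m, rfl⟩ : ∃ n, m = n + 1 := ⟨m - 1, by omega⟩
      rcases c with ⟨_ | _, c⟩
      · have := ihr _ m rfl (by omega)
        simp only [UntilP, UntilQ, UntilR] at this ⊢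
        tauto
      · have := ihp _ m rfl (by omega)
        simp only [UntilP, UntilQ] at this ⊢
        tauto
    · rw [hA.r hm] at ha
      exact .inr ⟨ha, ihp x m rfl hm⟩

lemma until_q_of_entry (hA : Stable k A) (hp : A (.p true k)) (h : Entry k A B) (x : Bool)
    {m : ℕ} (hm : k < m) : Until A B (.q x m) := by
  obtain ⟨hq, y, hy⟩ := h
  have step : ∀ z n, k ≤ n → Until A B (.q y n) → Until A B (.q z (n + 1)) := fun z n hn h =>
    .step (true, y) ((hA.q (by omega)).2 hq) (.step (true, y) ((hA.p hn).2 hp) h)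
  have up : ∀ n, k ≤ n → Until A B (.q y n) := fun n hn => by
    induction n, hn using Nat.le_induction with
    | base => exact hy
    | succ n hn ih => exact step y n hn ih
  obtain ⟨m, rfl⟩ : ∃ n, m = n + 1 := ⟨m - 1, by omega⟩
  exact step x m (by omega) (up m (by omega))

lemma until_p_iff (hA : Stable k A) (hB : Stable k B) {x : Bool} {m : ℕ} (hm : k < m) :
    Until A B (.p x m) ↔ UntilP k A B := by
  refine ⟨fun h => (h.high hA hB).1 x m rfl hm.le, ?_⟩
  rintro (h | ⟨hp, h | ⟨hq, hr⟩ | h⟩)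
  · exact .base ((hB.p hm.le).2 h)
  · exact .step default ((hA.p hm.le).2 hp) (.base ((hB.q hm.le).2 h))
  · refine .step default ((hA.p hm.le).2 hp) (.step (false, false) ((hA.q hm.le).2 hq) ?_)
    obtain ⟨m, rfl⟩ : ∃ n, m = n + 1 := ⟨m - 1, by omega⟩
    exact .base ((hB.r (by omega)).2 hr)
  · exact .step default ((hA.p hm.le).2 hp) (until_q_of_entry hA hp h x hm)

lemma until_q_iff (hA : Stable k A) (hB : Stable k B) {x : Bool} {m : ℕ} (hm : k < m) :
    Until A B (.q x m) ↔ UntilQ k A B := by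
  refine ⟨fun h => (h.high hA hB).2.1 x m rfl hm, ?_⟩
  rintro (h | ⟨hq, h⟩)
  · exact .base ((hB.q hm.le).2 h)
  obtain ⟨m, rfl⟩ : ∃ n, m = n + 1 := ⟨m - 1, by omega⟩
  rcases h with h | h | ⟨hp, h⟩
  · exact .step (true, true) ((hA.q hm.le).2 hq) (.base ((hB.p (by omega)).2 h))
  · exact .step (false, true) ((hA.q hm.le).2 hq) (.base ((hB.r (by omega)).2 h))
  · exact until_q_of_entry hA hp h x hm

lemma until_r_iff (hA : Stable k A) (hB : Stable k B) {x : Bool} {m : ℕ} (hm : k < m) :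
    Until A B (.r x m) ↔ UntilR k A B := by
  refine ⟨fun h => (h.high hA hB).2.2 x m rfl hm.le, ?_⟩
  rintro (h | ⟨hr, h⟩)
  · exact .base ((hB.r hm.le).2 h)
  · exact .step default ((hA.r hm.le).2 hr) ((until_p_iff hA hB hm).2 h)

lemma Stable.until (hA : Stable k A) (hB : Stable k B) : Stable (k + 1) (Until A B) where
  p hm := (until_p_iff hA hB hm).trans (until_p_iff hA hB k.lt_succ_self).symm
  q hm := (until_q_iff hA hB hm).trans (until_q_iff hA hB k.lt_succ_self).symm
  r hm := (until_r_iff hA hB hm).trans (until_r_iff hA hB k.lt_succ_self).symm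

end St

lemma exists_stable (p q r s : AP) (φ : PCTLp AP) :
    ∃ k, St.Stable k (φ.StSat (St.label p q r s)) := by
  induction φ with
  | atom a =>
    refine ⟨1, fun _ => Iff.rfl, fun {x m} hm => ?_, fun _ => Iff.rfl⟩
    obtain ⟨m, rfl⟩ : ∃ n, m = n + 1 := ⟨m - 1, by omega⟩
    cases x <;> rfl
  | neg φ ih => exact ih.imp fun k h => h.not
  | or φ ψ ihφ ihψ =>
    obtain ⟨k, hk⟩ := ihφ
    obtain ⟨l, hl⟩ := ihψ
    exact ⟨max k l, (hk.mono (le_max_left _ _)).or (hl.mono (le_max_right _ _))⟩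
  | D n φ ih =>
    obtain ⟨k, hk⟩ := ih
    exact ⟨k + 1, .exists fun f => .const_and _ (.forall fun j => hk.next (f j))⟩
  | EX φ ih =>
    obtain ⟨k, hk⟩ := ih
    exact ⟨k + 1, .exists fun c => hk.next c⟩
  | EU φ ψ ihφ ihψ =>
    obtain ⟨k, hk⟩ := ihφ
    obtain ⟨l, hl⟩ := ihψ
    exact ⟨max k l + 1, (hk.mono (le_max_left _ _)).until (hl.mono (le_max_right _ _))⟩
  | Y φ => exact ⟨0, fun _ => Iff.rfl, fun _ => Iff.rfl, fun _ => Iff.rfl⟩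
  | S φ ψ => exact ⟨0, fun _ => Iff.rfl, fun _ => Iff.rfl, fun _ => Iff.rfl⟩

/-- The path that always takes direction `c`. -/
def constPath (c : Bool × Bool) : ℕ → List (Bool × Bool) := fun n => List.replicate n c

lemma isInfPath_constPath (c : Bool × Bool) : IsInfPath fullTree (constPath c) :=
  ⟨rfl, fun _ => ⟨c, rfl⟩⟩

lemma stateAt_constPath (n : ℕ) {i : ℕ} (hi : i ≤ n) :
    stateAt (.q true n) (constPath (false, true) (3 * i)) = .q true (n - i) := by
  induction i with
  | zero => rfl
  | succ i ih =>
    obtain ⟨m, hm⟩ : ∃ m, n - i = m + 1 := ⟨n - i - 1, by omega⟩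
    have : n - (i + 1) = m := by omega
    have h := ih (by omega)
    simp only [constPath] at h ⊢
    rw [show 3 * (i + 1) = 3 * i + 1 + 1 + 1 by ring]
    simp [List.replicate_succ, stateAt, h, hm, this, St.next]

lemma eStarSat_true (p q r s : AP) (n : ℕ) {π : ℕ → List (Bool × Bool)}
    (hπ : IsInfPath fullTree π) :
    EStarSat fullTree (fun v => St.label p q r s (stateAt (.q true n) v)) p q r s π 0 := by
  set c : Bool × Bool := (false, true) with hc
  have succ : ∀ k, stateAt (.q true n) (constPath c (k + 1)) =
      (stateAt (.q true n) (constPath c k)).next c := fun k => rfl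
  refine ⟨constPath c, isInfPath_constPath _, ?_, 3 * n, Nat.zero_le _, ?_, fun k _ hk => ?_⟩
  · intro k hk
    obtain rfl : k = 0 := by omega
    exact hπ.1.symm
  · simp [hc, stateAt_constPath n le_rfl, St.label]
  · obtain ⟨i, e, he, rfl⟩ : ∃ i e, e < 3 ∧ k = 3 * i + e := ⟨k / 3, k % 3, by omega, by omega⟩
    obtain ⟨m, hm⟩ : ∃ m, n - i = m + 1 := ⟨n - i - 1, by omega⟩
    have h₀ : stateAt (.q true n) (constPath c (3 * i)) = .q true (m + 1) := by
      rw [hc, stateAt_constPath n (by omega), hm]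
    have h₁ : stateAt (.q true n) (constPath c (3 * i + 1)) = .r true m := by
      rw [succ, h₀]; rfl
    have h₂ : stateAt (.q true n) (constPath c (3 * i + 2)) = .p true m := by
      rw [succ, h₁]; rfl
    interval_cases e
    · refine .inr ⟨3 * i + 1, by omega, by simp [h₁, St.label], fun l h h' => ?_⟩
      obtain rfl : l = 3 * i := by omega
      simp [h₀, St.label]
    · exact .inr ⟨3 * i + 1, le_rfl, by simp [h₁, St.label], fun l h h' => by omega⟩
    · exact .inl (by simp [h₂, St.label])

/-- The flag of a state. -/
def St.flag : St → Bool
  | .p x _ => x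
  | .q x _ => x
  | .r x _ => x

lemma St.flag_next {y : St} (c : Bool × Bool) (hy : y.flag = false) :
    (y.next c).flag = false ∨ ∃ m, y = .q false (m + 1) ∧ y.next c = .p true m := by
  rcases y with ⟨x, m⟩ | ⟨x, _ | m⟩ | ⟨x, m⟩ <;> obtain rfl : x = false := hy
  · exact .inl rfl
  · exact .inl rfl
  · rcases c with ⟨_ | _, _ | _⟩
    · exact .inl rfl
    · exact .inl rfl
    · exact .inl rfl
    · exact .inr ⟨m, rfl, rfl⟩
  · exact .inl rfl

lemma not_eStarSat_false {p q r s : AP} (hpq : p ≠ q) (hpr : p ≠ r) (hps : p ≠ s)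
    (hqr : q ≠ r) (hqs : q ≠ s) (hrs : r ≠ s) (n : ℕ) (π : ℕ → List (Bool × Bool)) :
    ¬ EStarSat fullTree (fun v => St.label p q r s (stateAt (.q false n) v)) p q r s π 0 := by
  rintro ⟨π', hπ', -, j, -, hs, h⟩
  have inv : ∀ k ≤ j, (stateAt (.q false n) (π' k)).flag = false := by
    intro k hk
    induction k with
    | zero => rw [hπ'.1]; rfl
    | succ k ih =>
      obtain ⟨c, hc⟩ := hπ'.2 k
      have next : stateAt (.q false n) (π' (k + 1)) = (stateAt (.q false n) (π' k)).next c := by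
        rw [hc]; rfl
      rw [next]
      refine (St.flag_next c (ih (by omega))).resolve_right ?_
      rintro ⟨m, h₀, h₁⟩
      rw [← next] at h₁
      rcases h k (Nat.zero_le _) hk with hp | ⟨l, hkl, hr, hq⟩
      · simp only [h₀, St.label, Set.mem_singleton_iff] at hp
        exact hpq hp
      · rcases hkl.eq_or_lt with rfl | hkl
        · simp only [h₀, St.label, Set.mem_singleton_iff] at hr
          exact hqr hr.symm
        rcases (Nat.succ_le_of_lt hkl).eq_or_lt with rfl | hkl
        · simp only [Nat.succ_eq_add_one, h₁, St.label, Set.mem_singleton_iff] at hr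
          exact hpr hr.symm
        · have := hq (k + 1) (by omega) hkl
          simp only [h₁, St.label, Set.mem_singleton_iff] at this
          exact hpq this.symm
  have hflag := inv j le_rfl
  change s ∈ St.label p q r s (stateAt (.q false n) (π' j)) at hs
  generalize stateAt (.q false n) (π' j) = y at hs hflag
  rcases y with ⟨x, m⟩ | ⟨x, _ | m⟩ | ⟨x, m⟩ <;> obtain rfl : x = false := hflag
  · exact hps hs.symm
  · exact hs
  · exact hqs hs.symm
  · exact hrs hs.symm

end Models

end FOTrees

open FOTrees in
/-- polcCTL is strictly less expressive than polcCTL(p): some polcCTL(p)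
formula is equivalent (over Σ-trees and infinite paths, at position 0) to the
CTL* formula `E((p ∨ q U r) U s)`, while no polcCTL formula (i.e. no
polcCTL(p) formula without past operators) is. -/
theorem stmt11 (AP : Type) [Fintype AP] (p q r s : AP)
    (hpq : p ≠ q) (hpr : p ≠ r) (hps : p ≠ s)
    (hqr : q ≠ r) (hqs : q ≠ s) (hrs : r ≠ s) :
    (∃ φ : PCTLp AP, ∀ (V : Type) (t : FOTrees.Tree V) (τ : V → Set AP)
        (π : ℕ → V), IsInfPath t π →
        (PCTLp.Sat t τ φ π 0 ↔ EStarSat t τ p q r s π 0)) ∧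
    ¬ (∃ φ : PCTLp AP, φ.NoPast ∧ ∀ (V : Type) (t : FOTrees.Tree V)
        (τ : V → Set AP) (π : ℕ → V), IsInfPath t π →
        (PCTLp.Sat t τ φ π 0 ↔ EStarSat t τ p q r s π 0)) := by
  refine ⟨⟨.EU (safeFormula p q r) (goalFormula p q r s),
    fun V t τ π _ => sat_past_iff_eStarSat p q r s t τ π⟩, ?_⟩
  rintro ⟨φ, hφ, h⟩
  obtain ⟨k, hk⟩ := exists_stable p q r s φ
  have hπ := isInfPath_constPath (false, true)
  have sat_iff : ∀ x, φ.StSat (St.label p q r s) (.q x k) ↔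
      EStarSat fullTree (fun v => St.label p q r s (stateAt (.q x k) v)) p q r s
        (constPath (false, true)) 0 := fun x =>
    (sat_iff_stSat (.q x k) (St.label p q r s) hφ hπ 0).symm.trans (h _ _ _ _ hπ)
  exact not_eStarSat_false hpq hpr hps hqr hqs hrs k _
    ((sat_iff false).1 ((hk.q le_rfl).2 ((sat_iff true).2 (eStarSat_true p q r s k hπ))))
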